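/- Let (P, 𝒪) be a semitopology and p ∈ P. Then p is regular if and only if p is weakly regular and unconflicted. (Regular = weakly regular + unconflicted.) -/

import Mathlib

namespace Semitop

variable {P : Type*}

/-- A semitopology: a collection of open sets containing `∅` and `univ`,
closed under arbitrary unions. -/
def IsSemitop (𝒪 : Set (Set P)) : Prop :=
  ∅ ∈ 𝒪 ∧ Set.univ ∈ 𝒪 ∧ ∀ S ⊆ 𝒪, ⋃₀ S ∈ 𝒪

/-- `T` is transitive: any two opens that intersect `T` intersect each other. -/
def IsTrans (𝒪 : Set (Set P)) (T : Set P) : Prop :=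
  ∀ O ∈ 𝒪, ∀ O' ∈ 𝒪, (O ∩ T).Nonempty → (T ∩ O').Nonempty → (O ∩ O').Nonempty

/-- A topen is a nonempty transitive open set. -/
def IsTopen (𝒪 : Set (Set P)) (T : Set P) : Prop :=
  T.Nonempty ∧ IsTrans 𝒪 T ∧ T ∈ 𝒪

/-- A maximal topen: a topen contained in no strictly larger topen. -/
def MaxTopen (𝒪 : Set (Set P)) (S : Set P) : Prop :=
  IsTopen 𝒪 S ∧ ∀ S', IsTopen 𝒪 S' → S ⊆ S' → S' = S

/-- `f` (into a discrete space of values) is continuous at `p`: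
`f` is constant on some open neighbourhood of `p`. -/
def ContAt (𝒪 : Set (Set P)) {Val : Type*} (f : P → Val) (p : P) : Prop :=
  ∃ O ∈ 𝒪, p ∈ O ∧ ∀ q ∈ O, f q = f p

/-- `p` and `p'` are intertwined: every open neighbourhood of `p`
intersects every open neighbourhood of `p'`. -/
def Intw (𝒪 : Set (Set P)) (p p' : P) : Prop :=
  ∀ O ∈ 𝒪, ∀ O' ∈ 𝒪, p ∈ O → p' ∈ O' → (O ∩ O').Nonempty

/-- The set of points intertwined with `p`. -/
def intwSet (𝒪 : Set (Set P)) (p : P) : Set P := {p' | Intw 𝒪 p p'}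

/-- The interior of `R`: the union of all open subsets of `R`. -/
def sInterior (𝒪 : Set (Set P)) (R : Set P) : Set P := ⋃₀ {O | O ∈ 𝒪 ∧ O ⊆ R}

/-- The community of `p`: the interior of the set of points intertwined with `p`. -/
def community (𝒪 : Set (Set P)) (p : P) : Set P := sInterior 𝒪 (intwSet 𝒪 p)

/-- `p` is regular: `p ∈ community p` and `community p` is topen. -/
def Regular (𝒪 : Set (Set P)) (p : P) : Prop :=
  p ∈ community 𝒪 p ∧ IsTopen 𝒪 (community 𝒪 p)

/-- `p` is weakly regular: `p ∈ community p`. -/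
def WeaklyRegular (𝒪 : Set (Set P)) (p : P) : Prop := p ∈ community 𝒪 p

/-- Closure of a set: points all of whose open neighbourhoods intersect the set. -/
def sClosure (𝒪 : Set (Set P)) (S : Set P) : Set P :=
  {q | ∀ O ∈ 𝒪, q ∈ O → (O ∩ S).Nonempty}

/-- A set is closed when it equals its closure. -/
def IsClosedS (𝒪 : Set (Set P)) (C : Set P) : Prop := C = sClosure 𝒪 C

/-- `C` is a closed neighbourhood of `p`: closed with `p` in its interior. -/
def ClosedNbhdOf (𝒪 : Set (Set P)) (C : Set P) (p : P) : Prop :=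
  IsClosedS 𝒪 C ∧ p ∈ sInterior 𝒪 C

/-- `C` is a closed neighbourhood: closed with nonempty interior. -/
def ClosedNbhd (𝒪 : Set (Set P)) (C : Set P) : Prop :=
  IsClosedS 𝒪 C ∧ (sInterior 𝒪 C).Nonempty

/-- `p` is unconflicted: being intertwined is transitive through `p`. -/
def Unconflicted (𝒪 : Set (Set P)) (p : P) : Prop :=
  ∀ p' p'', Intw 𝒪 p' p → Intw 𝒪 p p'' → Intw 𝒪 p' p''

/-- `p` is strongly compatible: if `O'` and `O''` each intersect every
open neighbourhood of `p`, then `O'` intersects `O''`. -/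
def StrongCompat (𝒪 : Set (Set P)) (p : P) : Prop :=
  ∀ O' ∈ 𝒪, ∀ O'' ∈ 𝒪,
    (∀ O ∈ 𝒪, p ∈ O → (O' ∩ O).Nonempty ∧ (O ∩ O'').Nonempty) →
      (O' ∩ O'').Nonempty

theorem Intw.symm {𝒪 : Set (Set P)} {p q : P} (h : Intw 𝒪 p q) : Intw 𝒪 q p := by
  intro O hO O' hO' hq hp
  rw [Set.inter_comm]
  exact h O' hO' O hO hp hq

theorem sInterior_subset (𝒪 : Set (Set P)) (R : Set P) : sInterior 𝒪 R ⊆ R :=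
  Set.sUnion_subset fun _ hO => hO.2

theorem IsSemitop.sInterior_mem {𝒪 : Set (Set P)} (h : IsSemitop 𝒪) (R : Set P) :
    sInterior 𝒪 R ∈ 𝒪 :=
  h.2.2 _ fun _ hO => hO.1

/-- A point of a topen is unconflicted. -/
theorem IsTopen.unconflicted {𝒪 : Set (Set P)} {T : Set P} (hT : IsTopen 𝒪 T) {p : P}
    (hp : p ∈ T) : Unconflicted 𝒪 p := by
  obtain ⟨-, htrans, hopen⟩ := hT
  intro p' p'' h h' O hO O' hO' hp' hp''
  exact htrans O hO O' hO' (h O hO T hopen hp' hp) (h' T hopen O' hO' hp hp'')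

/-- The points intertwined with an unconflicted point form a transitive set,
as does any subset of them. -/
theorem Unconflicted.isTrans {𝒪 : Set (Set P)} {p : P} (h : Unconflicted 𝒪 p) {T : Set P}
    (hT : T ⊆ intwSet 𝒪 p) : IsTrans 𝒪 T := by
  rintro O hO O' hO' ⟨x, hxO, hxT⟩ ⟨y, hyT, hyO'⟩
  exact h x y (Intw.symm (hT hxT)) (hT hyT) O hO O' hO' hxO hyO'

theorem regular_iff_weaklyRegular_unconflicted {P : Type*}
    (𝒪 : Set (Set P)) (hST : IsSemitop 𝒪) (p : P) :
    Regular 𝒪 p ↔ (WeaklyRegular 𝒪 p ∧ Unconflicted 𝒪 p) := by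
  constructor
  · rintro ⟨hp, hK⟩
    exact ⟨hp, hK.unconflicted hp⟩
  · rintro ⟨hp, hu⟩
    exact ⟨hp, ⟨p, hp⟩, hu.isTrans (sInterior_subset 𝒪 _), hST.sInterior_mem _⟩

end Semitop
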